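/- arXiv:2010.15659 — 2 statements merged into one kernel-verified Lean document; each statement's English description precedes it below -/
import Mathlib

section
/- Let Y be an ℝ^n-valued Gaussian random vector with mean μ ∈ ℝ^n and positive definite covariance Σ ∈ ℝ^{n×n}, let η ∈ ℝ^n be nonzero, let A ∈ ℝ^{k×n} and b ∈ ℝ^k, and assume P(AY ≤ b) > 0. Set C = (η^TΣη)^{-1}Ση and Z = (Id − Cη^T)Y. Then, under the conditional probability measure given the event {AY ≤ b}, the random variable F^{[V^−(Z),V^+(Z)]}_{η^Tμ, η^TΣη}(η^T Y) is uniformly distributed on (0,1). -/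
open Matrix MeasureTheory ProbabilityTheory

/-- Lower truncation point `V⁻(z)` (with convention `-∞` for an empty index set). -/
noncomputable def Vminus {k n : ℕ} (A : Matrix (Fin k) (Fin n) ℝ) (b : Fin k → ℝ)
    (C z : Fin n → ℝ) : EReal :=
  ⨆ j : {j : Fin k // A.mulVec C j < 0},
    (((b j.1 - A.mulVec z j.1) / A.mulVec C j.1 : ℝ) : EReal)

/-- Upper truncation point `V⁺(z)` (with convention `+∞` for an empty index set). -/
noncomputable def Vplus {k n : ℕ} (A : Matrix (Fin k) (Fin n) ℝ) (b : Fin k → ℝ)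
    (C z : Fin n → ℝ) : EReal :=
  ⨅ j : {j : Fin k // 0 < A.mulVec C j},
    (((b j.1 - A.mulVec z j.1) / A.mulVec C j.1 : ℝ) : EReal)

/-- The standard normal cumulative distribution function `Φ`. -/
noncomputable def stdNormalCDF (x : ℝ) : ℝ :=
  ((gaussianReal 0 1) (Set.Iic x)).toReal

/-- `Φ((a - μ)/σ)` for an extended-real argument `a`, with conventions `Φ(-∞) = 0`,
`Φ(+∞) = 1`. -/
noncomputable def stdNormalCDFAff (μ σ : ℝ) (a : EReal) : ℝ :=
  if a = ⊥ then 0 else if a = ⊤ then 1 else stdNormalCDF ((a.toReal - μ) / σ)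

/-- The cdf of the Gaussian `N(μ, σ²)` truncated to `[a, b] ⊆ [-∞, +∞]`:
`F(x) = (Φ((x-μ)/σ) - Φ((a-μ)/σ)) / (Φ((b-μ)/σ) - Φ((a-μ)/σ))`. -/
noncomputable def truncGaussCDF (μ σ : ℝ) (a b : EReal) (x : ℝ) : ℝ :=
  (stdNormalCDF ((x - μ) / σ) - stdNormalCDFAff μ σ a) /
    (stdNormalCDFAff μ σ b - stdNormalCDFAff μ σ a)

/-- `Y` is a Gaussian random vector with mean `μ` and covariance `Σ` under `P`:
every linear functional `u ⬝ᵥ Y` has the Gaussian law `N(u ⬝ᵥ μ, uᵀ Σ u)`. -/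
def IsGaussianVector {Ω : Type*} [MeasurableSpace Ω] (P : Measure Ω) {n : ℕ}
    (Y : Ω → Fin n → ℝ) (μ : Fin n → ℝ) (Cov : Matrix (Fin n) (Fin n) ℝ) : Prop :=
  ∀ u : Fin n → ℝ,
    P.map (fun ω => u ⬝ᵥ Y ω) = gaussianReal (u ⬝ᵥ μ) (Real.toNNReal (u ⬝ᵥ Cov.mulVec u))

lemma continuous_cdf (ν : Measure ℝ) [IsProbabilityMeasure ν] [NullSingletonClass ν] :
    Continuous (cdf ν) := by
  refine continuous_iff_continuousAt.2 fun a ↦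
    continuousAt_iff_continuous_left'_right'.2 ⟨?_, ?_⟩
  · rw [(monotone_cdf ν).continuousWithinAt_Iio_iff_leftLim_eq]
    have h : (cdf ν).measure {a} = 0 := by rw [measure_cdf, measure_singleton]
    rw [StieltjesFunction.measure_singleton, ENNReal.ofReal_eq_zero] at h
    exact le_antisymm ((monotone_cdf ν).leftLim_le le_rfl) (by linarith)
  · exact ((cdf ν).right_continuous a).mono Set.Ioi_subset_Ici_self

lemma strictMono_cdf (ν : Measure ℝ) [IsProbabilityMeasure ν] [ν.IsOpenPosMeasure] :
    StrictMono (cdf ν) := by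
  intro x y hxy
  have h : 0 < (cdf ν).measure (Set.Ioc x y) := by
    rw [measure_cdf]
    exact ((Measure.measure_Ioo_pos ν).2 hxy).trans_le (measure_mono Set.Ioo_subset_Ioc_self)
  rw [StieltjesFunction.measure_Ioc, ENNReal.ofReal_pos] at h
  linarith

/-- The probability integral transform. -/
lemma map_cdf_eq_uniform (ν : Measure ℝ) [IsProbabilityMeasure ν] [NullSingletonClass ν]
    [ν.IsOpenPosMeasure] :
    ν.map (cdf ν) = volume.restrict (Set.Ioo (0 : ℝ) 1) := by
  have hc := continuous_cdf ν
  have hs := strictMono_cdf ν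
  have h0 (x : ℝ) : 0 < cdf ν x := (cdf_nonneg ν (x - 1)).trans_lt (hs (by linarith))
  have h1 (x : ℝ) : cdf ν x < 1 := (hs (show x < x + 1 by linarith)).trans_le (cdf_le_one ν _)
  have := Measure.isProbabilityMeasure_map (μ := ν) hc.aemeasurable
  refine Measure.ext_of_Iic _ _ fun t ↦ ?_
  rw [Measure.map_apply hc.measurable measurableSet_Iic,
    Measure.restrict_apply measurableSet_Iic]
  rcases le_or_gt t 0 with ht | ht
  · have e1 : cdf ν ⁻¹' Set.Iic t = ∅ := by
      ext x; simpa using ht.trans_lt (h0 x)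
    have e2 : Set.Iic t ∩ Set.Ioo 0 1 = ∅ := by
      ext x; simp; intros; linarith
    simp [e1, e2]
  rcases le_or_gt 1 t with ht1 | ht1
  · have e1 : cdf ν ⁻¹' Set.Iic t = Set.univ := by
      ext x; simpa using (h1 x).le.trans ht1
    have e2 : Set.Iic t ∩ Set.Ioo 0 1 = Set.Ioo 0 1 :=
      Set.inter_eq_right.2 fun x hx ↦ hx.2.le.trans ht1
    simp [e1, e2]
  obtain ⟨x, rfl⟩ : t ∈ Set.range (cdf ν) :=
    mem_range_of_exists_le_of_exists_ge hc
      ((tendsto_cdf_atBot ν).eventually_le_const ht).exists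
      ((tendsto_cdf_atTop ν).eventually_const_le ht1).exists
  have e1 : cdf ν ⁻¹' Set.Iic (cdf ν x) = Set.Iic x := by
    ext y; simp [hs.le_iff_le]
  have e2 : Set.Iic (cdf ν x) ∩ Set.Ioo 0 1 = Set.Ioc 0 (cdf ν x) := by
    ext y
    simp only [Set.mem_inter_iff, Set.mem_Iic, Set.mem_Ioo, Set.mem_Ioc]
    exact ⟨fun h ↦ ⟨h.2.1, h.1⟩, fun h ↦ ⟨h.2, h.1, h.2.trans_lt ht1⟩⟩
  rw [e1, e2, Real.volume_Ioc, sub_zero, ofReal_cdf]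

lemma cdf_gaussianReal_eq (m : ℝ) {v : ℝ} (hv : 0 < v) (x : ℝ) :
    cdf (gaussianReal m v.toNNReal) x = stdNormalCDF ((x - m) / √v) := by
  have hs : 0 < √v := Real.sqrt_pos.2 hv
  have hmap : (gaussianReal m v.toNNReal).map (fun y ↦ (y - m) / √v) = gaussianReal 0 1 := by
    have h := gaussianReal_map_div_const (μ := m - m) (v := v.toNNReal) (√v)
    rw [← gaussianReal_map_sub_const, Measure.map_map (by fun_prop) (by fun_prop)] at h
    rw [sub_self, zero_div] at h
    refine h.trans ?_
    congr 1
    rw [← NNReal.coe_inj]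
    simp [Real.sq_sqrt hv.le, hv.le, hv.ne']
  rw [cdf_eq_real, stdNormalCDF, ← hmap, Measure.map_apply (by fun_prop) measurableSet_Iic,
    Measure.real]
  congr 2
  ext y
  simp [div_le_div_iff_of_pos_right hs]

lemma nullSingletonClass_gaussianReal_toNNReal (m : ℝ) {v : ℝ} (hv : 0 < v) :
    NullSingletonClass (gaussianReal m v.toNNReal) :=
  nullSingletonClass_gaussianReal (by simpa using hv)

lemma isOpenPosMeasure_gaussianReal (m : ℝ) {v : ℝ} (hv : 0 < v) :
    (gaussianReal m v.toNNReal).IsOpenPosMeasure :=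
  (gaussianReal_absolutelyContinuous' m (by simpa using hv)).isOpenPosMeasure

lemma stdNormalCDFAff_coe (m s x : ℝ) :
    stdNormalCDFAff m s (x : EReal) = stdNormalCDF ((x - m) / s) := by
  simp [stdNormalCDFAff]

lemma stdNormalCDF_eq_cdf (x : ℝ) : stdNormalCDF x = cdf (gaussianReal 0 1) x := by
  rw [cdf_eq_real, stdNormalCDF, Measure.real]

lemma stdNormalCDFAff_mem_Icc (m s : ℝ) (a : EReal) :
    stdNormalCDFAff m s a ∈ Set.Icc (0 : ℝ) 1 := by
  unfold stdNormalCDFAff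
  split_ifs
  · simp
  · simp
  · rw [stdNormalCDF_eq_cdf]
    exact ⟨cdf_nonneg _ _, cdf_le_one _ _⟩

lemma monotone_stdNormalCDFAff (m : ℝ) {s : ℝ} (hs : 0 < s) :
    Monotone (stdNormalCDFAff m s) := by
  intro a b hab
  induction a with
  | bot => simpa [stdNormalCDFAff] using (stdNormalCDFAff_mem_Icc m s b).1
  | top => rw [top_le_iff.1 hab]
  | coe a =>
    induction b with
    | bot => simp at hab
    | top => simpa [stdNormalCDFAff] using (stdNormalCDFAff_mem_Icc m s a).2
    | coe b =>
      rw [EReal.coe_le_coe_iff] at hab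
      rw [stdNormalCDFAff_coe, stdNormalCDFAff_coe, stdNormalCDF_eq_cdf, stdNormalCDF_eq_cdf]
      exact monotone_cdf _ (by gcongr)

lemma measurable_stdNormalCDF : Measurable stdNormalCDF := by
  rw [funext stdNormalCDF_eq_cdf]
  exact (monotone_cdf _).measurable

lemma measurable_stdNormalCDFAff (m : ℝ) {s : ℝ} (hs : 0 < s) :
    Measurable (stdNormalCDFAff m s) :=
  (monotone_stdNormalCDFAff m hs).measurable

lemma uniform_Ioo_inter_preimage {α β : ℝ} (hα : 0 ≤ α) (hβ : β ≤ 1) {T : Set ℝ}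
    (hT : MeasurableSet T) :
    volume.restrict (Set.Ioo (0 : ℝ) 1)
        (Set.Ioo α β ∩ (fun u ↦ (u - α) / (β - α)) ⁻¹' T)
      = volume.restrict (Set.Ioo (0 : ℝ) 1) (Set.Ioo α β) *
        volume.restrict (Set.Ioo (0 : ℝ) 1) T := by
  rcases le_or_gt β α with h | h
  · simp [Set.Ioo_eq_empty_of_le h]
  have hd : 0 < β - α := sub_pos.2 h
  have hsub : Set.Ioo α β ⊆ Set.Ioo 0 1 := Set.Ioo_subset_Ioo hα hβ
  have hpre : Set.Ioo α β ∩ (fun u ↦ (u - α) / (β - α)) ⁻¹' T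
      = (fun u ↦ u + -α) ⁻¹' ((fun u ↦ u * (β - α)⁻¹) ⁻¹' (T ∩ Set.Ioo 0 1)) := by
    ext u
    simp only [Set.mem_inter_iff, Set.mem_Ioo, Set.mem_preimage, ← sub_eq_add_neg,
      ← div_eq_mul_inv, div_pos_iff_of_pos_right hd, div_lt_one hd, sub_pos,
      sub_lt_sub_iff_right]
    tauto
  rw [Measure.restrict_apply' measurableSet_Ioo, Measure.restrict_apply' measurableSet_Ioo,
    Measure.restrict_apply hT, Set.inter_eq_left.2 hsub,
    Set.inter_eq_left.2 (Set.inter_subset_left.trans hsub), hpre, measure_preimage_add_right,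
    Real.volume_preimage_mul_right (inv_ne_zero hd.ne'), inv_inv, abs_of_pos hd, Real.volume_Ioo]

/-- Under the Gaussian law restricted to `[a, b]`, the truncated Gaussian cdf is uniform. -/
lemma gaussianReal_truncGaussCDF_preimage (m : ℝ) {v : ℝ} (hv : 0 < v) (a b : EReal) {T : Set ℝ}
    (hT : MeasurableSet T) :
    gaussianReal m v.toNNReal
        {x : ℝ | (a ≤ (x : EReal) ∧ (x : EReal) ≤ b) ∧ truncGaussCDF m (√v) a b x ∈ T}
      = gaussianReal m v.toNNReal {x : ℝ | a ≤ (x : EReal) ∧ (x : EReal) ≤ b} *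
        volume.restrict (Set.Ioo (0 : ℝ) 1) T := by
  set γ := gaussianReal m v.toNNReal
  have := nullSingletonClass_gaussianReal_toNNReal m hv
  have := isOpenPosMeasure_gaussianReal m hv
  have hmono := monotone_stdNormalCDFAff m (Real.sqrt_pos.2 hv)
  have hG (x : ℝ) : stdNormalCDFAff m (√v) x = cdf γ x := by
    rw [stdNormalCDFAff_coe, cdf_gaussianReal_eq m hv]
  have hGm : Measurable (cdf γ) := (monotone_cdf γ).measurable
  set α := stdNormalCDFAff m (√v) a
  set β := stdNormalCDFAff m (√v) b
  have hF (x : ℝ) : truncGaussCDF m (√v) a b x = (cdf γ x - α) / (β - α) := by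
    rw [truncGaussCDF, cdf_gaussianReal_eq m hv]
  have hnull (c : ℝ) : γ (cdf γ ⁻¹' {c}) = 0 := by
    rw [← Measure.map_apply hGm (measurableSet_singleton c), map_cdf_eq_uniform]
    simp
  have hae : ∀ᵐ x : ℝ ∂γ, (a ≤ (x : EReal) ∧ (x : EReal) ≤ b) ↔ cdf γ x ∈ Set.Ioo α β := by
    filter_upwards [measure_eq_zero_iff_ae_notMem.1 (hnull α),
      measure_eq_zero_iff_ae_notMem.1 (hnull β)] with x hxα hxβ
    refine ⟨fun ⟨h1, h2⟩ ↦ ⟨lt_of_le_of_ne ?_ (Ne.symm hxα), lt_of_le_of_ne ?_ hxβ⟩,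
      fun ⟨h1, h2⟩ ↦ ⟨?_, ?_⟩⟩
    · rw [← hG]; exact hmono h1
    · rw [← hG]; exact hmono h2
    · rw [← hG] at h1; exact (hmono.reflect_lt h1).le
    · rw [← hG] at h2; exact (hmono.reflect_lt h2).le
  have e1 : γ {x : ℝ | a ≤ (x : EReal) ∧ (x : EReal) ≤ b} = γ (cdf γ ⁻¹' Set.Ioo α β) := by
    refine measure_congr ?_
    filter_upwards [hae] with x hx
    exact propext hx
  have e2 : γ {x : ℝ | (a ≤ (x : EReal) ∧ (x : EReal) ≤ b) ∧ truncGaussCDF m (√v) a b x ∈ T}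
      = γ (cdf γ ⁻¹' (Set.Ioo α β ∩ (fun u ↦ (u - α) / (β - α)) ⁻¹' T)) := by
    refine measure_congr ?_
    filter_upwards [hae] with x hx
    refine propext (and_congr hx ?_)
    rw [hF]
    rfl
  rw [e1, e2, ← Measure.map_apply hGm measurableSet_Ioo, ← Measure.map_apply hGm
    (measurableSet_Ioo.inter (hT.preimage (by fun_prop))), map_cdf_eq_uniform]
  exact uniform_Ioo_inter_preimage (stdNormalCDFAff_mem_Icc _ _ _).1
    (stdNormalCDFAff_mem_Icc _ _ _).2 hT

lemma Vminus_le_coe_iff {k n : ℕ} (A : Matrix (Fin k) (Fin n) ℝ) (b : Fin k → ℝ)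
    (C z : Fin n → ℝ) (x : ℝ) :
    Vminus A b C z ≤ x ↔
      ∀ j, A.mulVec C j < 0 → A.mulVec z j + A.mulVec C j * x ≤ b j := by
  simp only [Vminus, iSup_le_iff, EReal.coe_le_coe_iff, Subtype.forall]
  refine forall₂_congr fun j hj ↦ ?_
  rw [div_le_iff_of_neg hj]
  constructor <;> intro h <;> linarith

lemma coe_le_Vplus_iff {k n : ℕ} (A : Matrix (Fin k) (Fin n) ℝ) (b : Fin k → ℝ)
    (C z : Fin n → ℝ) (x : ℝ) :
    x ≤ Vplus A b C z ↔
      ∀ j, 0 < A.mulVec C j → A.mulVec z j + A.mulVec C j * x ≤ b j := by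
  simp only [Vplus, le_iInf_iff, EReal.coe_le_coe_iff, Subtype.forall]
  refine forall₂_congr fun j hj ↦ ?_
  rw [le_div_iff₀ hj]
  constructor <;> intro h <;> linarith

/-- The polyhedral selection event, expressed through the truncation points. -/
lemma forall_mulVec_add_le_iff {k n : ℕ} (A : Matrix (Fin k) (Fin n) ℝ) (b : Fin k → ℝ)
    (C z : Fin n → ℝ) (x : ℝ) :
    (∀ j, A.mulVec z j + A.mulVec C j * x ≤ b j) ↔
      (∀ j, A.mulVec C j = 0 → A.mulVec z j ≤ b j) ∧
        Vminus A b C z ≤ x ∧ x ≤ Vplus A b C z := by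
  rw [Vminus_le_coe_iff, coe_le_Vplus_iff]
  refine ⟨fun h ↦ ⟨fun j hj ↦ by simpa [hj] using h j, fun j _ ↦ h j, fun j _ ↦ h j⟩, ?_⟩
  rintro ⟨h0, hneg, hpos⟩ j
  rcases lt_trichotomy (A.mulVec C j) 0 with hj | hj | hj
  · exact hneg j hj
  · simpa [hj] using h0 j hj
  · exact hpos j hj

lemma measurable_mulVec_apply {k n : ℕ} (A : Matrix (Fin k) (Fin n) ℝ) (j : Fin k) :
    Measurable fun z : Fin n → ℝ ↦ A.mulVec z j := by
  unfold Matrix.mulVec dotProduct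
  fun_prop

lemma measurable_Vminus {k n : ℕ} (A : Matrix (Fin k) (Fin n) ℝ) (b : Fin k → ℝ)
    (C : Fin n → ℝ) : Measurable (Vminus A b C) :=
  Measurable.iSup fun j ↦
    (((measurable_mulVec_apply A j.1).const_sub _).div_const _).coe_real_ereal

lemma measurable_Vplus {k n : ℕ} (A : Matrix (Fin k) (Fin n) ℝ) (b : Fin k → ℝ)
    (C : Fin n → ℝ) : Measurable (Vplus A b C) :=
  Measurable.iInf fun j ↦
    (((measurable_mulVec_apply A j.1).const_sub _).div_const _).coe_real_ereal

lemma measurable_truncGaussCDF_comp (m : ℝ) {s : ℝ} (hs : 0 < s) {E : Type*} [MeasurableSpace E]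
    {f g : E → EReal} {h : E → ℝ} (hf : Measurable f) (hg : Measurable g) (hh : Measurable h) :
    Measurable fun e ↦ truncGaussCDF m s (f e) (g e) (h e) := by
  unfold truncGaussCDF
  have hf' := (measurable_stdNormalCDFAff m hs).comp hf
  have hg' := (measurable_stdNormalCDFAff m hs).comp hg
  exact ((measurable_stdNormalCDF.comp ((hh.sub_const m).div_const s)).sub hf').div (hg'.sub hf')

lemma IsGaussianVector.charFun_map {Ω : Type*} [MeasurableSpace Ω] {P : Measure Ω} {n : ℕ}
    {Y : Ω → Fin n → ℝ} {μ : Fin n → ℝ} {Cov : Matrix (Fin n) (Fin n) ℝ}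
    (hY : IsGaussianVector P Y μ Cov) (hCov : Cov.PosDef) (u : Fin n → ℝ) :
    charFun (P.map fun ω ↦ u ⬝ᵥ Y ω) 1 =
      Complex.exp ((u ⬝ᵥ μ : ℝ) * Complex.I - (u ⬝ᵥ Cov.mulVec u : ℝ) / 2) := by
  have h : 0 ≤ u ⬝ᵥ Cov.mulVec u := by simpa using hCov.posSemidef.dotProduct_mulVec_nonneg u
  rw [hY u, charFun_gaussianReal, Real.coe_toNNReal _ h]
  simp

lemma strongDual_pi_apply {n : ℕ} (L : StrongDual ℝ (Fin n → ℝ)) (z : Fin n → ℝ) :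
    L z = (fun i ↦ L (Pi.single i 1)) ⬝ᵥ z := by
  conv_lhs => rw [← Finset.univ_sum_single z]
  rw [map_sum, dotProduct]
  refine Finset.sum_congr rfl fun i _ ↦ ?_
  rw [mul_comm, ← smul_eq_mul, ← map_smul, ← Pi.single_smul, smul_eq_mul, mul_one]

/-- The residual of the regression of a Gaussian vector `Y` on `η ⬝ᵥ Y` is independent of
`η ⬝ᵥ Y`. -/
lemma IsGaussianVector.indepFun_residual {Ω : Type*} [MeasurableSpace Ω] {P : Measure Ω}
    [IsProbabilityMeasure P] {n : ℕ} {Y : Ω → Fin n → ℝ} (hYm : Measurable Y) {μ : Fin n → ℝ}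
    {Cov : Matrix (Fin n) (Fin n) ℝ} (hCov : Cov.PosDef) (hY : IsGaussianVector P Y μ Cov)
    {η : Fin n → ℝ} (hη : η ≠ 0) :
    IndepFun (fun ω ↦ Y ω - (η ⬝ᵥ Y ω) • ((η ⬝ᵥ Cov.mulVec η)⁻¹ • Cov.mulVec η))
      (fun ω ↦ η ⬝ᵥ Y ω) P := by
  set v := η ⬝ᵥ Cov.mulVec η with hv
  set C := v⁻¹ • Cov.mulVec η with hC
  have hvpos : 0 < v := by simpa using hCov.dotProduct_mulVec_pos hη
  have hXm : Measurable fun ω ↦ η ⬝ᵥ Y ω := by unfold dotProduct; fun_prop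
  have hZm : Measurable fun ω ↦ Y ω - (η ⬝ᵥ Y ω) • C := by fun_prop
  have hsymm (x y : Fin n → ℝ) : x ⬝ᵥ Cov.mulVec y = y ⬝ᵥ Cov.mulVec x := by
    have hT : Covᵀ = Cov := by simpa [Matrix.IsHermitian] using hCov.isHermitian
    rw [Matrix.dotProduct_mulVec, ← Matrix.mulVec_transpose, hT, dotProduct_comm]
  rw [indepFun_iff_charFunDual_prod hZm.aemeasurable hXm.aemeasurable]
  intro L
  set w : Fin n → ℝ := fun i ↦ L (Pi.single i 1, 0)
  set t : ℝ := L (0, 1) with ht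
  set p : Fin n → ℝ := w - (w ⬝ᵥ C) • η with hp
  have hL1 (z : Fin n → ℝ) : L (z, 0) = w ⬝ᵥ z :=
    strongDual_pi_apply (L.comp (.inl ℝ (Fin n → ℝ) ℝ)) z
  have hL2 (x : ℝ) : L (0, x) = t * x := by
    rw [ht, mul_comm, ← smul_eq_mul, ← map_smul]
    simp
  have hL (z : Fin n → ℝ) (x : ℝ) : L (z, x) = w ⬝ᵥ z + t * x := by
    rw [← hL1, ← hL2, ← map_add]
    simp
  have hwZ (y : Fin n → ℝ) : w ⬝ᵥ (y - (η ⬝ᵥ y) • C) = p ⬝ᵥ y := by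
    simp only [hp, dotProduct_sub, sub_dotProduct, dotProduct_smul, smul_dotProduct, smul_eq_mul]
    ring
  have hpη : p ⬝ᵥ Cov.mulVec η = 0 := by
    simp only [hp, hC, sub_dotProduct, smul_dotProduct, dotProduct_smul, smul_eq_mul, ← hv]
    field_simp
    ring
  have e1 : charFunDual (P.map fun ω ↦ (Y ω - (η ⬝ᵥ Y ω) • C, η ⬝ᵥ Y ω)) L =
      charFun (P.map fun ω ↦ (p + t • η) ⬝ᵥ Y ω) 1 := by
    rw [charFunDual_eq_charFun_map_one, Measure.map_map (by fun_prop) (hZm.prodMk hXm)]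
    congr 2
    ext ω
    rw [Function.comp_apply, hL, hwZ, add_dotProduct, smul_dotProduct, smul_eq_mul]
  have e2 : charFunDual (P.map fun ω ↦ Y ω - (η ⬝ᵥ Y ω) • C)
      (L.comp (.inl ℝ (Fin n → ℝ) ℝ)) = charFun (P.map fun ω ↦ p ⬝ᵥ Y ω) 1 := by
    rw [charFunDual_eq_charFun_map_one, Measure.map_map (by fun_prop) hZm]
    congr 2
    ext ω
    exact (hL1 _).trans (hwZ _)
  have e3 : charFunDual (P.map fun ω ↦ η ⬝ᵥ Y ω)
      (L.comp (.inr ℝ (Fin n → ℝ) ℝ)) = charFun (P.map fun ω ↦ (t • η) ⬝ᵥ Y ω) 1 := by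
    rw [charFunDual_eq_charFun_map_one, Measure.map_map (by fun_prop) hXm]
    congr 2
    ext ω
    rw [smul_dotProduct]
    exact hL2 _
  have hvar : (p + t • η) ⬝ᵥ Cov.mulVec (p + t • η) =
      p ⬝ᵥ Cov.mulVec p + (t • η) ⬝ᵥ Cov.mulVec (t • η) := by
    simp only [Matrix.mulVec_add, Matrix.mulVec_smul, add_dotProduct, dotProduct_add,
      dotProduct_smul, smul_dotProduct, hsymm η p, hpη, smul_eq_mul]
    ring
  rw [e1, e2, e3, hY.charFun_map hCov, hY.charFun_map hCov, hY.charFun_map hCov,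
    ← Complex.exp_add, hvar, add_dotProduct]
  congr 1
  push_cast
  ring

/-- **Polyhedral lemma pivot (Theorem 5.2 of Lee et al.).** Conditionally on the selection
event `{A Y ≤ b}`, the truncated-Gaussian cdf evaluated at `ηᵀY` is uniform on `(0,1)`. -/
theorem truncGauss_pivot_uniform {Ω : Type*} [MeasurableSpace Ω] (P : Measure Ω)
    [IsProbabilityMeasure P] {n k : ℕ}
    (Y : Ω → Fin n → ℝ) (hYm : Measurable Y)
    (μ : Fin n → ℝ) (Cov : Matrix (Fin n) (Fin n) ℝ) (hCov : Cov.PosDef)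
    (hY : IsGaussianVector P Y μ Cov)
    (η : Fin n → ℝ) (hη : η ≠ 0)
    (A : Matrix (Fin k) (Fin n) ℝ) (b : Fin k → ℝ)
    (hsel : 0 < P {ω | ∀ j, A.mulVec (Y ω) j ≤ b j})
    (C : Fin n → ℝ) (hC : C = (η ⬝ᵥ Cov.mulVec η)⁻¹ • Cov.mulVec η)
    (Z : Ω → Fin n → ℝ) (hZ : ∀ ω, Z ω = fun i => Y ω i - C i * (η ⬝ᵥ Y ω)) :
    (P[|{ω | ∀ j, A.mulVec (Y ω) j ≤ b j}]).map
        (fun ω => truncGaussCDF (η ⬝ᵥ μ) (Real.sqrt (η ⬝ᵥ Cov.mulVec η))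
          (Vminus A b C (Z ω)) (Vplus A b C (Z ω)) (η ⬝ᵥ Y ω))
      = volume.restrict (Set.Ioo (0 : ℝ) 1) := by
  set v := η ⬝ᵥ Cov.mulVec η with hv
  set m := η ⬝ᵥ μ
  have hvpos : 0 < v := by simpa using hCov.dotProduct_mulVec_pos hη
  have hs : 0 < √v := Real.sqrt_pos.2 hvpos
  have hZeq : Z = fun ω ↦ Y ω - (η ⬝ᵥ Y ω) • C := by
    ext ω i
    simp [hZ, mul_comm]
  have hXm : Measurable fun ω ↦ η ⬝ᵥ Y ω := by unfold dotProduct; fun_prop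
  have hZm : Measurable Z := by rw [hZeq]; fun_prop
  have hind : IndepFun Z (fun ω ↦ η ⬝ᵥ Y ω) P := by
    rw [hZeq, hC]
    exact hY.indepFun_residual hYm hCov hη
  have hjoint := (indepFun_iff_map_prod_eq_prod_map_map hZm.aemeasurable hXm.aemeasurable).1 hind
  rw [hY η] at hjoint
  have hAY (ω : Ω) (j : Fin k) :
      A.mulVec (Y ω) j = A.mulVec (Z ω) j + A.mulVec C j * (η ⬝ᵥ Y ω) := by
    simp [hZeq, Matrix.mulVec_sub, Matrix.mulVec_smul, mul_comm]
  set F : (Fin n → ℝ) × ℝ → ℝ := fun q ↦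
    truncGaussCDF m (√v) (Vminus A b C q.1) (Vplus A b C q.1) q.2
  have hFm : Measurable F := measurable_truncGaussCDF_comp m hs
    ((measurable_Vminus A b C).comp measurable_fst) ((measurable_Vplus A b C).comp measurable_fst)
    measurable_snd
  set D : Set ((Fin n → ℝ) × ℝ) :=
    {q | ∀ j, A.mulVec q.1 j + A.mulVec C j * q.2 ≤ b j} with hD
  have hDm : MeasurableSet D := by
    rw [hD, Set.ofPred_forall]
    refine MeasurableSet.iInter fun j ↦ measurableSet_le ?_ measurable_const
    exact ((measurable_mulVec_apply A j).comp measurable_fst).add (measurable_snd.const_mul _)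
  have hZX : Measurable fun ω ↦ (Z ω, η ⬝ᵥ Y ω) := hZm.prodMk hXm
  have hE : {ω | ∀ j, A.mulVec (Y ω) j ≤ b j} = (fun ω ↦ (Z ω, η ⬝ᵥ Y ω)) ⁻¹' D := by
    ext ω
    simp [hD, hAY]
  have hslice (T : Set ℝ) (hT : MeasurableSet T) (z : Fin n → ℝ) :
      gaussianReal m v.toNNReal (Prod.mk z ⁻¹' (D ∩ F ⁻¹' T)) =
        gaussianReal m v.toNNReal (Prod.mk z ⁻¹' D) *
          volume.restrict (Set.Ioo (0 : ℝ) 1) T := by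
    have h := gaussianReal_truncGaussCDF_preimage m hvpos (Vminus A b C z) (Vplus A b C z) hT
    by_cases hz : ∀ j, A.mulVec C j = 0 → A.mulVec z j ≤ b j
    · have e (x : ℝ) : (z, x) ∈ D ↔ Vminus A b C z ≤ x ∧ x ≤ Vplus A b C z :=
        (forall_mulVec_add_le_iff A b C z x).trans (and_iff_right hz)
      convert h using 2
      · ext x
        exact and_congr_left' (e x)
      · congr 1
        ext x
        exact e x
    · have e : Prod.mk z ⁻¹' D = ∅ := by
        ext x
        exact iff_of_false (fun hx ↦ hz ((forall_mulVec_add_le_iff A b C z x).1 hx).1)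
          (Set.notMem_empty x)
      simp [e]
  rw [hE] at hsel ⊢
  change (P[|_]).map (F ∘ fun ω ↦ (Z ω, η ⬝ᵥ Y ω)) = _
  ext T hT
  rw [Measure.map_apply (hFm.comp hZX) hT, cond_apply (hZX hDm), Set.preimage_comp,
    ← Set.preimage_inter, ← Measure.map_apply hZX hDm,
    ← Measure.map_apply hZX (hDm.inter (hFm hT)), hjoint,
    Measure.prod_apply (hDm.inter (hFm hT)), lintegral_congr (hslice T hT),
    lintegral_mul_const _ (measurable_measure_prodMk_left hDm), ← Measure.prod_apply hDm,
    ← hjoint, Measure.map_apply hZX hDm, ← mul_assoc,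
    ENNReal.inv_mul_cancel hsel.ne' (measure_ne_top _ _), one_mul]
end

section
/- Let H ∈ ℝ^p, let M ∈ ℝ^{p×p} be symmetric positive definite, let λ > 0 and let w ∈ ℝ^p have nonnegative entries. Let β̂ be the unique minimizer over the nonnegative orthant ℝ^p_+ of f(β) = −β^T H + (1/2) β^T M β + λ β^T w, let Ŝ = {s : β̂_s > 0}, and for j ∈ {1,…,p} let β̂_{−j} denote β̂ with its j-th entry set to zero. Then j ∈ Ŝ if and only if H_j > e_j^T M β̂_{−j} + λ w_j, where e_j is the j-th standard basis vector. -/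
open Matrix

/-- The normal weighted HSIC-Lasso objective
`f(β) = -βᵀH + (1/2) βᵀMβ + λ βᵀw`. -/
noncomputable def hsicLassoObj {p : ℕ} (H : Fin p → ℝ) (M : Matrix (Fin p) (Fin p) ℝ)
    (lam : ℝ) (w : Fin p → ℝ) (β : Fin p → ℝ) : ℝ :=
  -(β ⬝ᵥ H) + (1 / 2) * (β ⬝ᵥ M.mulVec β) + lam * (β ⬝ᵥ w)

/-- Along a coordinate direction the objective is a quadratic polynomial. -/
theorem hsicLassoObj_add_single {p : ℕ} (H : Fin p → ℝ) {M : Matrix (Fin p) (Fin p) ℝ}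
    (hM : M.IsSymm) (lam : ℝ) (w β : Fin p → ℝ) (j : Fin p) (t : ℝ) :
    hsicLassoObj H M lam w (β + Pi.single j t) =
      hsicLassoObj H M lam w β + t * (M.mulVec β j + lam * w j - H j) +
        t ^ 2 / 2 * M j j := by
  have hcross : β ⬝ᵥ M.mulVec (Pi.single j t) = t * M.mulVec β j := by
    rw [dotProduct_mulVec, ← mulVec_transpose, hM.eq, dotProduct_single, mul_comm]
  have hdiag : M.mulVec (Pi.single j t) j = M j j * t := by
    simp [mulVec]
  simp only [hsicLassoObj, mulVec_add, add_dotProduct, dotProduct_add, single_dotProduct,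
    hcross, hdiag]
  ring

/-- **Characterisation of the selection event `{j ∈ Ŝ}`.** A feature `j` is selected
(`β̂ j > 0`) iff `H j > eⱼᵀ M β̂₋ⱼ + λ wⱼ`, where `β̂₋ⱼ` is `β̂` with its `j`-th entry
set to zero. -/
theorem hsicLasso_feature_selected_iff {p : ℕ} (H : Fin p → ℝ)
    (M : Matrix (Fin p) (Fin p) ℝ) (hM : M.PosDef)
    (lam : ℝ) (hlam : 0 < lam) (w : Fin p → ℝ) (hw : ∀ i, 0 ≤ w i)
    (βh : Fin p → ℝ) (hβh : ∀ i, 0 ≤ βh i)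
    (hmin : ∀ β : Fin p → ℝ, (∀ i, 0 ≤ β i) →
      hsicLassoObj H M lam w βh ≤ hsicLassoObj H M lam w β)
    (j : Fin p) :
    0 < βh j ↔ H j > M.mulVec (Function.update βh j 0) j + lam * w j := by
  set γ := Function.update βh j 0 with hγ
  have hsymm : M.IsSymm := by
    simpa [IsHermitian, IsSymm, conjTranspose_eq_transpose_of_trivial] using hM.isHermitian
  have ha : 0 < M j j := hM.diag_pos
  have hγ_nonneg : ∀ i, 0 ≤ γ i := by
    intro i
    rcases eq_or_ne i j with rfl | h
    · simp [hγ]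
    · simpa [hγ, h] using hβh i
  have hsplit : βh = γ + Pi.single j (βh j) := by
    ext i
    rcases eq_or_ne i j with rfl | h
    · simp [hγ]
    · simp [hγ, h]
  have hle : ∀ t, 0 ≤ t →
      βh j * (M.mulVec γ j + lam * w j - H j) + βh j ^ 2 / 2 * M j j ≤
        t * (M.mulVec γ j + lam * w j - H j) + t ^ 2 / 2 * M j j := by
    intro t ht
    have h := hmin (γ + Pi.single j t) fun i =>
      add_nonneg (hγ_nonneg i) ((Pi.single_nonneg.2 ht : (0 : Fin p → ℝ) ≤ Pi.single j t) i)
    rw [hsicLassoObj_add_single H hsymm lam w γ j t] at h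
    have h' := hsicLassoObj_add_single H hsymm lam w γ j (βh j)
    rw [← hsplit] at h'
    linarith
  constructor
  · intro hb
    have h := hle 0 le_rfl
    by_contra! hc
    nlinarith [mul_nonneg hb.le (sub_nonneg.2 hc), mul_pos (pow_pos hb 2) ha]
  · intro hc
    by_contra! hb
    have hb0 : βh j = 0 := le_antisymm hb (hβh j)
    set c := M.mulVec γ j + lam * w j - H j
    have hc0 : c < 0 := sub_neg.2 hc
    have h := hle (-c / M j j) (div_nonneg (neg_nonneg.2 hc0.le) ha.le)
    have hval : -c / M j j * c + (-c / M j j) ^ 2 / 2 * M j j = -(c ^ 2 / (2 * M j j)) := by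
      field_simp
      ring
    have hpos : 0 < c ^ 2 / (2 * M j j) := by
      have := hc0.ne
      positivity
    rw [hval, hb0] at h
    linarith
end
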